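/- Let (Ω,T) be a minimal subshift over a finite alphabet A with associated set of words W. Then the following are equivalent: (i) (Ω,T) is uniquely ergodic, i.e. for every v ∈ W the limit lim_{|w|→∞} ♯_v(w)/|w| (over w ∈ W) exists; (ii) for every Banach space B and every additive function F: W → B, the limit lim_{|w|→∞} F(w)/|w| exists (i.e. there is x ∈ B such that for every ε > 0 there is L with ‖F(w)/|w| − x‖ ≤ ε for all w ∈ W with |w| ≥ L); (iii) for every Banach space B and every continuous function f: Ω → B, the Birkhoff averages (1/n) Σ_{j=1}^n f(T^j ω) converge as n → ∞ uniformly in ω ∈ Ω. -/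

import Mathlib

open Filter Topology

namespace SubshiftErgodic

variable {A : Type*}

/-- The shift map `T` on two-sided sequences over `A`: `(T ω) n = ω (n+1)`. -/
def shift (ω : ℤ → A) : ℤ → A := fun n => ω (n + 1)

/-- The `n`-th power of the shift: `(shiftZ n ω) k = ω (k + n)`. -/
def shiftZ (n : ℤ) (ω : ℤ → A) : ℤ → A := fun k => ω (k + n)

/-- `Ω` is a subshift: a closed, shift-invariant subset of `A^ℤ`. -/
def IsSubshift [TopologicalSpace A] (Ω : Set (ℤ → A)) : Prop :=
  IsClosed Ω ∧ shift '' Ω = Ω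

/-- Minimality: every orbit `{T^n ω : n ∈ ℤ}` is dense in `Ω`. -/
def IsMinimal [TopologicalSpace A] (Ω : Set (ℤ → A)) : Prop :=
  ∀ ω ∈ Ω, Ω ⊆ closure {ρ | ∃ n : ℤ, ρ = shiftZ n ω}

/-- The finite word `w` occurs in the sequence `ω` at position `k`. -/
def OccursAt (w : List A) (ω : ℤ → A) (k : ℤ) : Prop :=
  ∀ i : Fin w.length, ω (k + (i : ℕ)) = w.get i

/-- The set `W = W(Ω)` of finite words occurring as factors of elements of `Ω`. -/
def words (Ω : Set (ℤ → A)) : Set (List A) :=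
  {w | ∃ ω ∈ Ω, ∃ k : ℤ, OccursAt w ω k}

/-- `v` occurs as a factor of the finite word `w` at position `i`. -/
def OccursIn (v w : List A) (i : ℕ) : Prop :=
  i + v.length ≤ w.length ∧ v <+: w.drop i

/-- `♯_v(w)`: the number of occurrences of `v` as a factor of `w`. -/
noncomputable def occ (v w : List A) : ℕ :=
  {i : ℕ | OccursIn v w i}.ncard

/-- `z` is a return word of `u` (relative to the set of words `W`). -/
def IsReturnWord (W : Set (List A)) (z u : List A) : Prop :=
  z ∈ W ∧ z ++ u ∈ W ∧ occ u (z ++ u) = 2 ∧ u <+: z ++ u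

/-- The maximal number of pairwise disjoint occurrences of `v` as a factor of `w`. -/
noncomputable def maxDisjoint (v w : List A) : ℕ :=
  sSup {m : ℕ | ∃ s : Fin m → ℕ, (∀ i, OccursIn v w (s i)) ∧
    ∀ i j : Fin m, i < j → s i + v.length ≤ s j}

/-- The filter expressing `|w| → ∞` along words `w ∈ W`. -/
def wordsFilter (W : Set (List A)) : Filter (List A) :=
  ⨅ L : ℕ, Filter.principal {w | w ∈ W ∧ L ≤ w.length}

/-- `lim_{|w| → ∞} g w = x` over `w ∈ W`: for every `ε > 0` there is `L` with
`‖g w - x‖ ≤ ε` for all `w ∈ W` with `|w| ≥ L`. -/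
def TendstoWords {B : Type*} [SeminormedAddCommGroup B] (W : Set (List A))
    (g : List A → B) (x : B) : Prop :=
  ∀ ε : ℝ, 0 < ε → ∃ L : ℕ, ∀ w ∈ W, L ≤ w.length → ‖g w - x‖ ≤ ε

/-- `liminf_{|w| → ∞} g w` over `w ∈ W`, valued in the extended reals. -/
noncomputable def liminfWords (W : Set (List A)) (g : List A → ℝ) : EReal :=
  Filter.liminf (fun w => (g w : EReal)) (wordsFilter W)

/-- `limsup_{|w| → ∞} g w` over `w ∈ W`, valued in the extended reals. -/
noncomputable def limsupWords (W : Set (List A)) (g : List A → ℝ) : EReal :=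
  Filter.limsup (fun w => (g w : EReal)) (wordsFilter W)

/-- `ν(v) = liminf_{|w| → ∞} l_v(w)/|w|`, where
`l_v(w) = (max number of pairwise disjoint copies of v in w) ⬝ |v|`. -/
noncomputable def nu (W : Set (List A)) (v : List A) : EReal :=
  liminfWords W (fun w => ((maxDisjoint v w * v.length : ℕ) : ℝ) / (w.length : ℝ))

/-- Condition (PQ): uniform positivity of quasiweights. -/
def PQ (W : Set (List A)) : Prop :=
  ∃ C : ℝ, 0 < C ∧ ∀ v ∈ W, v ≠ [] → (C : EReal) ≤ nu W v

/-- Unique ergodicity: all word frequencies `♯_v(w)/|w|` converge as `|w| → ∞`. -/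
def UniquelyErgodic (Ω : Set (ℤ → A)) : Prop :=
  ∀ v ∈ words Ω, ∃ x : ℝ,
    TendstoWords (words Ω) (fun w => (occ v w : ℝ) / (w.length : ℝ)) x

/-- `F : W → ℝ` is subadditive. -/
def IsSubadditive (W : Set (List A)) (F : List A → ℝ) : Prop :=
  ∀ a b : List A, a ∈ W → b ∈ W → a ++ b ∈ W → F (a ++ b) ≤ F a + F b

/-- `F^(n) = max { F v / |v| : v ∈ W, |v| = n }`. -/
noncomputable def wordSup (W : Set (List A)) (F : List A → ℝ) (n : ℕ) : ℝ :=
  sSup ((fun v => F v / (v.length : ℝ)) '' {v | v ∈ W ∧ v.length = n})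

/-- Condition (SET): the uniform subadditive ergodic theorem holds, i.e. for every
subadditive `F` the limit `lim_{|w|→∞} F(w)/|w|` exists and equals `inf_{n ≥ 1} F^(n)`
(in the extended reals). -/
def SET (W : Set (List A)) : Prop :=
  ∀ F : List A → ℝ, IsSubadditive W F →
    Filter.Tendsto (fun w => ((F w / (w.length : ℝ) : ℝ) : EReal)) (wordsFilter W)
      (nhds (⨅ n : {n : ℕ // 1 ≤ n}, ((wordSup W F n.1 : ℝ) : EReal)))

/-- A Banach-space-valued function `F : W → B` is additive. -/
def IsAdditive {B : Type*} [SeminormedAddCommGroup B] (W : Set (List A))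
    (F : List A → B) : Prop :=
  ∃ D : ℝ, 0 < D ∧ ∃ c : ℕ → ℝ, Antitone c ∧ (∀ n, 0 ≤ c n) ∧
    Filter.Tendsto c Filter.atTop (nhds 0) ∧
    (∀ vs : List (List A), (∀ v ∈ vs, v ∈ W) → vs.flatten ∈ W →
      ‖F vs.flatten - (vs.map F).sum‖ ≤ (vs.map fun v => c v.length * (v.length : ℝ)).sum) ∧
    ∀ v ∈ W, ‖F v‖ ≤ D * (v.length : ℝ)

/-- Condition (HP): powers in `W` have uniformly bounded exponent. -/
def HP (W : Set (List A)) : Prop :=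
  ∃ N : ℕ, 0 < N ∧ ∀ v : List A, v ≠ [] → ∀ k : ℕ,
    (List.replicate k v).flatten ∈ W → k ≤ N

/-- Condition (PW): uniform positivity of weights. -/
def PW (W : Set (List A)) : Prop :=
  ∃ E : ℝ, 0 < E ∧ ∀ v ∈ W, v ≠ [] →
    (E : EReal) ≤ liminfWords W (fun w => ((occ v w * v.length : ℕ) : ℝ) / (w.length : ℝ))

/-- Linear repetitivity. -/
def LinearlyRepetitive (W : Set (List A)) : Prop :=
  ∃ D : ℝ, 0 < D ∧ ∀ v ∈ W, v ≠ [] → ∀ w ∈ W, D * (v.length : ℝ) ≤ (w.length : ℝ) →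
    v <:+: w

/-- Aperiodicity: no element of `Ω` is periodic. -/
def Aperiodic (Ω : Set (ℤ → A)) : Prop :=
  ∀ ω ∈ Ω, ∀ p : ℕ, 1 ≤ p → shiftZ (p : ℤ) ω ≠ ω

/-- `m(n)`: the minimal length of a return word of a word of length `n` in `W`. -/
noncomputable def mRet (W : Set (List A)) (n : ℕ) : ℕ :=
  sInf {k : ℕ | ∃ v z : List A, v ∈ W ∧ v.length = n ∧ IsReturnWord W z v ∧ z.length = k}

/-- `k_ω^w`: the minimal nonnegative position at which `w` occurs in `ω`. -/
noncomputable def firstOcc (ω : ℤ → A) (w : List A) : ℕ :=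
  sInf {k : ℕ | OccursAt w ω (k : ℤ)}

/-- `F_ω(w) = ∑_{j=0}^{|w|-1} f(T^{k_ω^w + j} ω)`. -/
noncomputable def birkhoffF {B : Type*} [AddCommMonoid B] (f : (ℤ → A) → B)
    (ω : ℤ → A) (w : List A) : B :=
  ∑ j ∈ Finset.range w.length, f (shiftZ ((firstOcc ω w : ℤ) + (j : ℤ)) ω)


/-- The filter on a set `s` along which `len` tends to infinity. -/
def lenFilter {α : Type*} (s : Set α) (len : α → ℕ) : Filter α :=
  comap len atTop ⊓ 𝓟 s

theorem eventually_lenFilter {α : Type*} {s : Set α} {len : α → ℕ} {p : α → Prop} :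
    (∀ᶠ a in lenFilter s len, p a) ↔ ∃ L, ∀ a ∈ s, L ≤ len a → p a := by
  unfold lenFilter
  rw [eventually_inf_principal, eventually_comap, eventually_atTop]
  constructor
  · rintro ⟨L, h⟩
    exact ⟨L, fun a ha hL => h _ hL a rfl ha⟩
  · rintro ⟨L, h⟩
    exact ⟨L, fun b hb a hab ha => h a ha (hab ▸ hb)⟩

theorem tendsto_lenFilter_nhds {α B : Type*} [SeminormedAddCommGroup B] {s : Set α}
    {len : α → ℕ} {h : α → B} {x : B} :
    Tendsto h (lenFilter s len) (𝓝 x) ↔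
      ∀ ε : ℝ, 0 < ε → ∃ L : ℕ, ∀ a ∈ s, L ≤ len a → ‖h a - x‖ ≤ ε := by
  simp_rw [Metric.nhds_basis_closedBall.tendsto_right_iff, eventually_lenFilter,
    mem_closedBall_iff_norm]

theorem tendsto_len_lenFilter {α : Type*} (s : Set α) (len : α → ℕ) :
    Tendsto len (lenFilter s len) atTop :=
  tendsto_comap.mono_left inf_le_left

theorem exists_tendsto_of_forall_approx {α B : Type*} [NormedAddCommGroup B] [CompleteSpace B]
    {l : Filter α} {h : α → B}
    (H : ∀ ε : ℝ, 0 < ε → ∃ x, ∀ᶠ a in l, ‖h a - x‖ ≤ ε) : ∃ x, Tendsto h l (𝓝 x) := by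
  rcases l.eq_or_neBot with rfl | hl
  · exact ⟨0, tendsto_bot⟩
  refine CompleteSpace.complete (f := map h l) (Metric.cauchy_iff.2 ⟨inferInstance, ?_⟩)
  intro ε hε
  obtain ⟨x, hx⟩ := H (ε / 3) (by positivity)
  refine ⟨Metric.closedBall x (ε / 3), ?_, ?_⟩
  · exact mem_map.2 (mem_of_superset hx fun a ha => mem_closedBall_iff_norm.2 ha)
  · intro a ha b hb
    have := dist_triangle_right a b x
    rw [Metric.mem_closedBall] at ha hb
    linarith

theorem norm_sum_range_sub_le {B : Type*} [SeminormedAddCommGroup B] {φ : ℕ → B}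
    (hφ : ∀ i, ‖φ i‖ ≤ 1) {a b : ℕ} (hab : a ≤ b) :
    ‖∑ i ∈ Finset.range b, φ i - ∑ i ∈ Finset.range a, φ i‖ ≤ (b : ℝ) - a := by
  rw [← Finset.sum_Ico_eq_sub _ hab]
  refine (norm_sum_le_of_le _ (fun i _ => hφ i)).trans ?_
  simp [Nat.cast_sub hab]

theorem sum_range_residues {M : Type*} [AddCommMonoid M] (φ : ℕ → M) {n : ℕ} (hn : 0 < n)
    (N : ℕ) :
    ∑ j ∈ Finset.range n, ∑ t ∈ Finset.range ((N - j) / n), φ (j + n * t) =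
      ∑ i ∈ Finset.range (N + 1 - n), φ i := by
  rw [Finset.sum_sigma']
  refine Finset.sum_nbij' (fun p => p.1 + n * p.2) (fun i => ⟨i % n, i / n⟩) ?_ ?_ ?_ ?_ ?_
  · rintro ⟨j, t⟩ h
    simp only [Finset.mem_sigma, Finset.mem_range] at h ⊢
    have h2 := h.2
    rw [Nat.lt_iff_add_one_le, Nat.le_div_iff_mul_le hn, add_one_mul, mul_comm] at h2
    omega
  · intro i h
    simp only [Finset.mem_sigma, Finset.mem_range] at h ⊢
    refine ⟨Nat.mod_lt _ hn, ?_⟩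
    rw [Nat.lt_iff_add_one_le, Nat.le_div_iff_mul_le hn, add_one_mul, mul_comm]
    have := Nat.mod_add_div i n
    omega
  · rintro ⟨j, t⟩ h
    simp only [Finset.mem_sigma, Finset.mem_range] at h
    have h1 : (j + n * t) / n = t := by
      rw [Nat.add_mul_div_left _ _ hn, Nat.div_eq_of_lt h.1, zero_add]
    simp [Nat.add_mul_mod_self_left, Nat.mod_eq_of_lt h.1, h1]
  · intro i _
    exact Nat.mod_add_div i n
  · intros
    rfl

/-- The word of length `n` read in `ω` from position `k` on. -/
def factor (ω : ℤ → A) (k : ℤ) (n : ℕ) : List A :=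
  List.ofFn fun i : Fin n => ω (k + (i : ℕ))

@[simp]
theorem length_factor (ω : ℤ → A) (k : ℤ) (n : ℕ) : (factor ω k n).length = n := by
  simp [factor]

@[simp]
theorem factor_zero (ω : ℤ → A) (k : ℤ) : factor ω k 0 = [] := by
  simp [factor]

theorem factor_add (ω : ℤ → A) (k : ℤ) (p q : ℕ) :
    factor ω k (p + q) = factor ω k p ++ factor ω (k + p) q := by
  simp [factor, List.ofFn_add, add_assoc]

theorem factor_shiftZ (ω : ℤ → A) (j k : ℤ) (n : ℕ) :
    factor (shiftZ j ω) k n = factor ω (j + k) n := by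
  simp only [factor, shiftZ]
  congr 1
  ext i
  congr 1
  ring

theorem occursAt_iff {w : List A} {ω : ℤ → A} {k : ℤ} :
    OccursAt w ω k ↔ factor ω k w.length = w := by
  constructor
  · intro h
    refine List.ext_get (by simp) fun i h1 h2 => ?_
    simpa [factor] using h ⟨i, h2⟩
  · intro h i
    have : w.get i = (factor ω k w.length)[(i : ℕ)]'(by simp) := by simp [h]
    rw [this]
    simp [factor]

theorem factor_mem_words {Ω : Set (ℤ → A)} {ω : ℤ → A} (hω : ω ∈ Ω) (k : ℤ) (n : ℕ) :
    factor ω k n ∈ words Ω :=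
  ⟨ω, hω, k, occursAt_iff.2 (by simp)⟩

theorem exists_factor_of_mem_words {Ω : Set (ℤ → A)} {w : List A} (hw : w ∈ words Ω) :
    ∃ ω ∈ Ω, ∃ k n, w = factor ω k n := by
  obtain ⟨ω, hω, k, h⟩ := hw
  exact ⟨ω, hω, k, _, (occursAt_iff.1 h).symm⟩

theorem exists_eq_factor [Nonempty A] (w : List A) : ∃ ω : ℤ → A, w = factor ω 0 w.length := by
  inhabit A
  refine ⟨fun i => w.getD i.toNat default, (occursAt_iff.1 fun i => ?_).symm⟩
  simp

theorem take_drop_factor (ω : ℤ → A) (k : ℤ) {N i m : ℕ} (h : i + m ≤ N) :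
    ((factor ω k N).drop i).take m = factor ω (k + i) m := by
  obtain ⟨r, rfl⟩ := Nat.exists_eq_add_of_le h
  rw [factor_add, factor_add, List.append_assoc, List.drop_left' (by simp),
    List.take_left' (by simp)]

theorem occ_eq_card [DecidableEq A] (v w : List A) :
    occ v w = ((Finset.range (w.length + 1 - v.length)).filter
      fun i => (w.drop i).take v.length = v).card := by
  rw [occ, ← Set.ncard_coe_finset]
  congr 1
  ext i
  simp only [OccursIn, List.prefix_iff_eq_take, Set.mem_ofPred_eq, Finset.coe_filter,
    Finset.mem_range, eq_comm (a := v)]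
  exact and_congr_left fun _ => by omega

/-- The sum of `g` over all factors of length `m` of `w`, counted with multiplicity. -/
def windowSum {B : Type*} [AddCommMonoid B] (g : List A → B) (m : ℕ) (w : List A) : B :=
  ∑ i ∈ Finset.range (w.length + 1 - m), g ((w.drop i).take m)

theorem windowSum_factor {B : Type*} [AddCommMonoid B] (g : List A → B) (m : ℕ)
    (ω : ℤ → A) (k : ℤ) (N : ℕ) :
    windowSum g m (factor ω k N) = ∑ i ∈ Finset.range (N + 1 - m), g (factor ω (k + i) m) := by
  rw [windowSum, length_factor]
  refine Finset.sum_congr rfl fun i hi => ?_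
  rw [take_drop_factor]
  rw [Finset.mem_range] at hi
  omega

open Classical in
theorem occ_factor (v : List A) (ω : ℤ → A) (k : ℤ) (N : ℕ) :
    (occ v (factor ω k N) : ℝ) = ∑ i ∈ Finset.range (N + 1 - v.length),
      if factor ω (k + i) v.length = v then (1 : ℝ) else 0 := by
  rw [← windowSum_factor (fun u => if u = v then (1 : ℝ) else 0), windowSum, occ_eq_card]
  simp

open Classical in
theorem windowSum_eq_sum_occ [Fintype A] {B : Type*} [AddCommGroup B] [Module ℝ B]
    (g : List A → B) {m : ℕ} (w : List A) :
    windowSum g m w = ∑ u : Fin m → A, (occ (List.ofFn u) w : ℝ) • g (List.ofFn u) := by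
  have hmem : ∀ i ∈ Finset.range (w.length + 1 - m), (w.drop i).take m ∈
      Finset.univ.image (List.ofFn : (Fin m → A) → List A) := by
    intro i hi
    rw [Finset.mem_range] at hi
    have hl : ((w.drop i).take m).length = m := by simp; omega
    refine Finset.mem_image.2 ⟨fun j => ((w.drop i).take m)[(j : ℕ)]'(by omega),
      Finset.mem_univ _, List.ext_getElem (by simpa using hl.symm) ?_⟩
    intro j h1 h2
    simp
  rw [windowSum, ← Finset.sum_fiberwise_of_maps_to hmem,
    Finset.sum_image fun _ _ _ _ h => List.ofFn_injective h]
  refine Finset.sum_congr rfl fun u _ => ?_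
  rw [Finset.sum_congr rfl (g := fun _ => g (List.ofFn u))
    fun i hi => by rw [(Finset.mem_filter.1 hi).2], Finset.sum_const, occ_eq_card,
    Nat.cast_smul_eq_nsmul]
  simp

theorem occ_eq_zero_of_notMem {Ω : Set (ℤ → A)} {v w : List A} (hv : v ∉ words Ω)
    (hw : w ∈ words Ω) : occ v w = 0 := by
  classical
  obtain ⟨ω, hω, k, N, rfl⟩ := exists_factor_of_mem_words hw
  have : (occ v (factor ω k N) : ℝ) = 0 := by
    rw [occ_factor]
    refine Finset.sum_eq_zero fun i _ => if_neg fun h => hv ?_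
    rw [← h]
    exact factor_mem_words hω _ _
  exact_mod_cast this

theorem tendstoWords_iff {B : Type*} [SeminormedAddCommGroup B] {W : Set (List A)}
    {g : List A → B} {x : B} :
    TendstoWords W g x ↔ Tendsto g (lenFilter W List.length) (𝓝 x) :=
  tendsto_lenFilter_nhds.symm

theorem UniquelyErgodic.exists_tendsto_windowSum [Fintype A] {Ω : Set (ℤ → A)}
    (h : UniquelyErgodic Ω) {B : Type*} [NormedAddCommGroup B] [NormedSpace ℝ B]
    (g : List A → B) (m : ℕ) :
    ∃ x, Tendsto (fun w => (w.length : ℝ)⁻¹ • windowSum g m w)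
      (lenFilter (words Ω) List.length) (𝓝 x) := by
  have H : ∀ v : List A, ∃ x : ℝ, Tendsto (fun w => (occ v w : ℝ) / (w.length : ℝ))
      (lenFilter (words Ω) List.length) (𝓝 x) := by
    intro v
    by_cases hv : v ∈ words Ω
    · obtain ⟨x, hx⟩ := h v hv
      exact ⟨x, tendstoWords_iff.1 hx⟩
    · refine ⟨0, tendsto_const_nhds.congr' (eventually_lenFilter.2 ⟨0, fun w hw _ => ?_⟩)⟩
      simp [occ_eq_zero_of_notMem hv hw]
  choose x hx using H
  refine ⟨∑ u : Fin m → A, x (List.ofFn u) • g (List.ofFn u),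
    (tendsto_finsetSum _ fun u _ => (hx (List.ofFn u)).smul_const (g (List.ofFn u))).congr ?_⟩
  intro w
  rw [windowSum_eq_sum_occ, Finset.smul_sum]
  simp_rw [smul_smul, div_eq_inv_mul]

theorem shiftZ_mem [TopologicalSpace A] {Ω : Set (ℤ → A)} (hΩ : IsSubshift Ω) {ω : ℤ → A}
    (hω : ω ∈ Ω) (n : ℤ) : shiftZ n ω ∈ Ω := by
  induction n with
  | zero =>
    convert hω
    ext k
    simp [shiftZ]
  | succ n ih =>
    rw [← hΩ.2]
    refine ⟨_, ih, ?_⟩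
    ext k
    simp only [shift, shiftZ]
    congr 1
    ring
  | pred n ih =>
    rw [← hΩ.2] at ih
    obtain ⟨ρ, hρ, h⟩ := ih
    convert hρ
    ext k
    have := congrFun h (k - 1)
    simp only [shift, shiftZ, sub_add_cancel] at this ⊢
    rw [this]
    congr 1
    ring

theorem factor_blocks (ω : ℤ → A) (k : ℤ) (n q : ℕ) :
    ((List.range q).map fun t : ℕ => factor ω (k + (n * t : ℕ)) n).flatten =
      factor ω k (n * q) := by
  induction q with
  | zero => simp
  | succ q ih =>
    rw [List.range_succ, List.map_append, List.flatten_append, ih]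
    simp [mul_add, factor_add]

theorem norm_sub_sum_blocks_le {Ω : Set (ℤ → A)} {B : Type*} [NormedAddCommGroup B]
    {F : List A → B} {D : ℝ} {c : ℕ → ℝ} (hD : 0 < D) (hc : Antitone c) (hc0 : ∀ n, 0 ≤ c n)
    (hA : ∀ vs : List (List A), (∀ v ∈ vs, v ∈ words Ω) → vs.flatten ∈ words Ω →
      ‖F vs.flatten - (vs.map F).sum‖ ≤ (vs.map fun v => c v.length * (v.length : ℝ)).sum)
    (hF : ∀ v ∈ words Ω, ‖F v‖ ≤ D * (v.length : ℝ))
    {ω : ℤ → A} (hω : ω ∈ Ω) (k : ℤ) {n j N : ℕ} (hn : 0 < n) (hj : j < n) (hjN : j ≤ N) :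
    ‖F (factor ω k N) - ∑ t ∈ Finset.range ((N - j) / n), F (factor ω (k + (j + n * t : ℕ)) n)‖ ≤
      c n * N + 2 * n * (c 0 + D) := by
  set q := (N - j) / n with hq
  set r := (N - j) % n with hr
  have hr' : r < n := Nat.mod_lt _ hn
  have hN : N = j + n * q + r := by
    have : n * q + r = N - j := Nat.div_add_mod (N - j) n
    omega
  set vs : List (List A) := factor ω k j ::
    ((List.range q).map fun t : ℕ => factor ω (k + j + (n * t : ℕ)) n) ++
      [factor ω (k + (j + n * q : ℕ)) r] with hvs
  have hflat : vs.flatten = factor ω k N := by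
    rw [hN, factor_add, factor_add, hvs, List.flatten_append, List.flatten_cons, factor_blocks]
    simp
  have hmem : ∀ v ∈ vs, v ∈ words Ω := by
    intro v hv
    simp only [hvs, List.cons_append, List.mem_cons, List.mem_append, List.mem_map,
      List.not_mem_nil, or_false] at hv
    rcases hv with rfl | ⟨t, -, rfl⟩ | rfl <;> exact factor_mem_words hω _ _
  have hsum : (vs.map F).sum = F (factor ω k j) +
      ∑ t ∈ Finset.range q, F (factor ω (k + (j + n * t : ℕ)) n) +
        F (factor ω (k + (j + n * q : ℕ)) r) := by
    simp [hvs, Finset.sum, add_assoc, Function.comp_def, Multiset.range]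
  have hcsum : (vs.map fun v => c v.length * (v.length : ℝ)).sum =
      c j * j + q * (c n * n) + c r * r := by
    simp [hvs, Function.comp_def, add_assoc]
  have h := hA vs hmem (hflat ▸ factor_mem_words hω _ _)
  rw [hflat, hsum, hcsum] at h
  have e1 := hF _ (factor_mem_words hω k j)
  have e2 := hF _ (factor_mem_words hω (k + (j + n * q : ℕ)) r)
  rw [length_factor] at e1 e2
  have hjn : (j : ℝ) ≤ n := by exact_mod_cast hj.le
  have hrn : (r : ℝ) ≤ n := by exact_mod_cast hr'.le
  have b1 : c j * j ≤ c 0 * n := mul_le_mul (hc (Nat.zero_le _)) hjn (by positivity) (hc0 0)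
  have b2 : c r * r ≤ c 0 * n := mul_le_mul (hc (Nat.zero_le _)) hrn (by positivity) (hc0 0)
  have b3 : (q : ℝ) * (c n * n) ≤ c n * N := by
    have : (n * q : ℝ) ≤ N := by exact_mod_cast (by omega : n * q ≤ N)
    nlinarith [mul_le_mul_of_nonneg_left this (hc0 n)]
  have b4 := mul_le_mul_of_nonneg_left hjn hD.le
  have b5 := mul_le_mul_of_nonneg_left hrn hD.le
  set S := ∑ t ∈ Finset.range q, F (factor ω (k + (j + n * t : ℕ)) n)
  set P := F (factor ω k j)
  set Q := F (factor ω (k + (j + n * q : ℕ)) r)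
  have key : F (factor ω k N) - S = (F (factor ω k N) - (P + S + Q)) + P + Q := by abel
  rw [key]
  refine (norm_add₃_le).trans ?_
  linarith

theorem norm_sub_windowSum_le {Ω : Set (ℤ → A)} {B : Type*} [NormedAddCommGroup B]
    [NormedSpace ℝ B] {F : List A → B} {D : ℝ} {c : ℕ → ℝ} (hD : 0 < D) (hc : Antitone c)
    (hc0 : ∀ n, 0 ≤ c n)
    (hA : ∀ vs : List (List A), (∀ v ∈ vs, v ∈ words Ω) → vs.flatten ∈ words Ω →
      ‖F vs.flatten - (vs.map F).sum‖ ≤ (vs.map fun v => c v.length * (v.length : ℝ)).sum)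
    (hF : ∀ v ∈ words Ω, ‖F v‖ ≤ D * (v.length : ℝ))
    {w : List A} (hw : w ∈ words Ω) {n : ℕ} (hn : 0 < n) (hnw : n ≤ w.length) :
    ‖F w - (n : ℝ)⁻¹ • windowSum F n w‖ ≤ c n * w.length + 2 * n * (c 0 + D) := by
  obtain ⟨ω, hω, k, N, rfl⟩ := exists_factor_of_mem_words hw
  rw [length_factor] at hnw ⊢
  have hn' : (0 : ℝ) < n := by exact_mod_cast hn
  have h : F (factor ω k N) - (n : ℝ)⁻¹ • windowSum F n (factor ω k N) =
      (n : ℝ)⁻¹ • ∑ j ∈ Finset.range n, (F (factor ω k N) -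
        ∑ t ∈ Finset.range ((N - j) / n), F (factor ω (k + (j + n * t : ℕ)) n)) := by
    rw [windowSum_factor, Finset.sum_sub_distrib, Finset.sum_const, Finset.card_range,
      sum_range_residues (fun i => F (factor ω (k + (i : ℕ)) n)) hn, smul_sub,
      ← Nat.cast_smul_eq_nsmul ℝ, inv_smul_smul₀ hn'.ne']
  rw [h, norm_smul, norm_inv, Real.norm_natCast, inv_mul_le_iff₀ hn']
  refine (norm_sum_le_of_le _ fun j hj => norm_sub_sum_blocks_le hD hc hc0 hA hF hω k hn
    (Finset.mem_range.1 hj) ((Finset.mem_range.1 hj).le.trans hnw)).trans (le_of_eq ?_)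
  rw [Finset.sum_const, Finset.card_range, nsmul_eq_mul]

theorem UniquelyErgodic.exists_tendstoWords [Fintype A] {Ω : Set (ℤ → A)}
    (h : UniquelyErgodic Ω) {B : Type*} [NormedAddCommGroup B] [NormedSpace ℝ B]
    [CompleteSpace B] {F : List A → B} (hF : IsAdditive (words Ω) F) :
    ∃ x : B, TendstoWords (words Ω) (fun w => ((w.length : ℝ))⁻¹ • F w) x := by
  obtain ⟨D, hD, c, hc, hc0, hlim, hA, hF⟩ := hF
  simp_rw [tendstoWords_iff]
  refine exists_tendsto_of_forall_approx fun ε hε => ?_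
  obtain ⟨n, hcn, hn⟩ := ((hlim.eventually_le_const (show 0 < ε / 3 by positivity)).and
    (eventually_gt_atTop 0)).exists
  obtain ⟨y, hy⟩ := h.exists_tendsto_windowSum F n
  refine ⟨(n : ℝ)⁻¹ • y, ?_⟩
  have h1 := Metric.tendsto_nhds.1 (hy.const_smul (n : ℝ)⁻¹) (ε / 3) (by positivity)
  have hlen := tendsto_len_lenFilter (words Ω) List.length
  have h2 := ((tendsto_const_div_atTop_nhds_zero_nat (2 * n * (c 0 + D))).comp
    hlen).eventually_le_const (show 0 < ε / 3 by positivity)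
  have h3 : ∀ᶠ w in lenFilter (words Ω) List.length, w ∈ words Ω :=
    eventually_lenFilter.2 ⟨0, fun w hw _ => hw⟩
  filter_upwards [h1, h2, h3, hlen.eventually_ge_atTop n] with w h1 h2 hw hnw
  have hpos : (0 : ℝ) < w.length := by exact_mod_cast hn.trans_le hnw
  have e := norm_sub_windowSum_le hD hc hc0 hA hF hw hn hnw
  rw [dist_eq_norm] at h1
  simp only [Function.comp_apply] at h2
  have key : (w.length : ℝ)⁻¹ • F w - (n : ℝ)⁻¹ • y =
      (w.length : ℝ)⁻¹ • (F w - (n : ℝ)⁻¹ • windowSum F n w) +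
        ((n : ℝ)⁻¹ • (w.length : ℝ)⁻¹ • windowSum F n w - (n : ℝ)⁻¹ • y) := by
    rw [smul_sub, smul_comm (n : ℝ)⁻¹ (w.length : ℝ)⁻¹]
    abel
  have e2 : ‖(w.length : ℝ)⁻¹ • (F w - (n : ℝ)⁻¹ • windowSum F n w)‖ ≤
      c n + 2 * n * (c 0 + D) / w.length := by
    rw [norm_smul, norm_inv, Real.norm_natCast, inv_mul_le_iff₀ hpos]
    refine e.trans (le_of_eq ?_)
    field_simp
  rw [key]
  refine (norm_add_le _ _).trans ?_
  linarith

theorem exists_norm_sub_le_of_factor_eq [Finite A] [TopologicalSpace A] [DiscreteTopology A]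
    {Ω : Set (ℤ → A)} (hΩ : IsClosed Ω) {B : Type*} [SeminormedAddCommGroup B]
    {f : (ℤ → A) → B} (hf : ContinuousOn f Ω) {ε : ℝ} (hε : 0 < ε) :
    ∃ m : ℕ, ∀ ω ∈ Ω, ∀ ρ ∈ Ω,
      (∀ i : ℤ, |i| ≤ m → ω i = ρ i) → ‖f ω - f ρ‖ ≤ ε := by
  refine hΩ.isCompact.induction_on (p := fun s => ∃ m : ℕ, ∀ ω ∈ s, ∀ ρ ∈ Ω,
      (∀ i : ℤ, |i| ≤ m → ω i = ρ i) → ‖f ω - f ρ‖ ≤ ε) ⟨0, by simp⟩ ?_ ?_ ?_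
  · rintro s t hst ⟨m, hm⟩
    exact ⟨m, fun ω hω => hm ω (hst hω)⟩
  · rintro s t ⟨m, hm⟩ ⟨m', hm'⟩
    refine ⟨max m m', ?_⟩
    rintro ω (hω | hω) ρ hρ h
    · exact hm ω hω ρ hρ fun i hi => h i (hi.trans (by simp))
    · exact hm' ω hω ρ hρ fun i hi => h i (hi.trans (by simp))
  · intro x hx
    have h1 : {ω | dist (f ω) (f x) < ε / 2} ∈ 𝓝[Ω] x :=
      Metric.tendsto_nhds.1 (hf x hx) _ (by positivity)
    obtain ⟨u, hu, hsub⟩ := mem_nhdsWithin_iff_exists_mem_nhds_inter.1 h1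
    rw [nhds_pi, Filter.mem_pi] at hu
    obtain ⟨I, hI, t, ht, htu⟩ := hu
    obtain ⟨m, hm⟩ : ∃ m : ℕ, ∀ i ∈ I, |i| ≤ (m : ℤ) := by
      obtain ⟨M, hM⟩ := (hI.image Int.natAbs).bddAbove
      refine ⟨M, fun i hi => ?_⟩
      rw [Int.abs_eq_natAbs]
      exact_mod_cast hM (Set.mem_image_of_mem Int.natAbs hi)
    have hclose : ∀ ω ∈ Ω, (∀ i : ℤ, |i| ≤ m → ω i = x i) → dist (f ω) (f x) < ε / 2 := by
      intro ω hω h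
      refine hsub ⟨htu fun i hi => ?_, hω⟩
      rw [h i (hm i hi)]
      exact mem_of_mem_nhds (ht i)
    refine ⟨{ω | ∀ i : ℤ, |i| ≤ m → ω i = x i} ∩ Ω, ?_, m, ?_⟩
    · refine inter_mem (mem_nhdsWithin_of_mem_nhds ?_) self_mem_nhdsWithin
      have hfin : {i : ℤ | |i| ≤ m}.Finite :=
        (Set.finite_Icc (-(m : ℤ)) m).subset fun i hi => abs_le.1 hi
      exact set_pi_mem_nhds hfin (s := fun i => {x i}) fun i _ => by simp
    · rintro ω ⟨hωx, hω⟩ ρ hρ h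
      have a := hclose ω hω hωx
      have b := hclose ρ hρ fun i hi => (h i hi).symm.trans (hωx i hi)
      have := dist_triangle_right (f ω) (f ρ) (f x)
      rw [dist_eq_norm] at this
      linarith

theorem UniquelyErgodic.exists_birkhoff_limit [Fintype A] [TopologicalSpace A]
    [DiscreteTopology A] {Ω : Set (ℤ → A)} (hΩ : IsSubshift Ω) (h : UniquelyErgodic Ω)
    {B : Type*} [NormedAddCommGroup B] [NormedSpace ℝ B] [CompleteSpace B]
    {f : (ℤ → A) → B} (hf : ContinuousOn f Ω) :
    ∃ x : B, ∀ ε : ℝ, 0 < ε → ∃ N : ℕ, ∀ n : ℕ, N ≤ n → ∀ ω ∈ Ω,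
      ‖(n : ℝ)⁻¹ • (∑ j ∈ Finset.range n, f (shiftZ ((j : ℤ) + 1) ω)) - x‖ ≤ ε := by
  classical
  set l : Filter (ℕ × (ℤ → A)) := lenFilter {p | p.2 ∈ Ω} Prod.fst with hl
  suffices H : ∃ x : B, Tendsto (fun p : ℕ × (ℤ → A) =>
      (p.1 : ℝ)⁻¹ • (∑ j ∈ Finset.range p.1, f (shiftZ ((j : ℤ) + 1) p.2))) l (𝓝 x) by
    obtain ⟨x, hx⟩ := H
    refine ⟨x, fun ε hε => ?_⟩
    obtain ⟨N, hN⟩ := tendsto_lenFilter_nhds.1 hx ε hε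
    exact ⟨N, fun n hn ω hω => hN (n, ω) hω hn⟩
  refine exists_tendsto_of_forall_approx fun ε hε => ?_
  obtain ⟨m, hm⟩ := exists_norm_sub_le_of_factor_eq hΩ.1 hf (half_pos hε)
  set g : List A → B := fun v =>
    if hv : ∃ ρ ∈ Ω, factor ρ (-m) (2 * m + 1) = v then f hv.choose else 0 with hg
  have hfg : ∀ ω ∈ Ω, ‖f ω - g (factor ω (-m) (2 * m + 1))‖ ≤ ε / 2 := by
    intro ω hω
    have hv : ∃ ρ ∈ Ω, factor ρ (-m) (2 * m + 1) = factor ω (-m) (2 * m + 1) := ⟨ω, hω, rfl⟩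
    rw [hg]
    simp only [dif_pos hv]
    refine hm _ hω _ hv.choose_spec.1 fun i hi => ?_
    have h2 := hv.choose_spec.2
    unfold factor at h2
    rw [List.ofFn_inj] at h2
    rw [abs_le] at hi
    have h3 := congrFun h2 ⟨(i + m).toNat, by omega⟩
    have h4 : (-(m : ℤ) + ((i + m).toNat : ℕ)) = i := by omega
    simp only [h4] at h3
    exact h3.symm
  obtain ⟨y, hy⟩ := h.exists_tendsto_windowSum g (2 * m + 1)
  have hfst : Tendsto Prod.fst l atTop := tendsto_len_lenFilter _ _
  have hwords : Tendsto (fun p : ℕ × (ℤ → A) => factor p.2 (1 - m) (p.1 + 2 * m)) l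
      (lenFilter (words Ω) List.length) := by
    refine tendsto_inf.2 ⟨tendsto_comap_iff.2 ?_, tendsto_principal.2 ?_⟩
    · simp only [Function.comp_def, length_factor]
      exact tendsto_atTop_mono (fun p => Nat.le_add_right _ _) hfst
    · exact eventually_lenFilter.2 ⟨0, fun p hp _ => factor_mem_words hp _ _⟩
  have hratio : Tendsto (fun p : ℕ × (ℤ → A) => 1 + (2 * m : ℝ) / (p.1 : ℝ)) l (𝓝 1) := by
    simpa using ((tendsto_const_div_atTop_nhds_zero_nat (2 * m : ℝ)).comp hfst).const_add 1
  have hlim := hratio.smul (hy.comp hwords)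
  rw [one_smul] at hlim
  refine ⟨y, ?_⟩
  have hΩl : ∀ᶠ p in l, p.2 ∈ Ω := eventually_lenFilter.2 ⟨0, fun p hp _ => hp⟩
  filter_upwards [Metric.tendsto_nhds.1 hlim (ε / 2) (half_pos hε), hΩl,
    hfst.eventually_gt_atTop 0] with p h1 hp hpos
  obtain ⟨n, ω⟩ := p
  simp only [Function.comp_apply, length_factor] at h1 hp hpos ⊢
  have hn : (0 : ℝ) < n := by exact_mod_cast hpos
  have hne : (1 + (2 * m : ℝ) / n) * ((n + 2 * m : ℕ) : ℝ)⁻¹ = (n : ℝ)⁻¹ := by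
    push_cast
    field_simp
  have hws : windowSum g (2 * m + 1) (factor ω (1 - m) (n + 2 * m)) =
      ∑ j ∈ Finset.range n, g (factor (shiftZ ((j : ℤ) + 1) ω) (-m) (2 * m + 1)) := by
    rw [windowSum_factor, show n + 2 * m + 1 - (2 * m + 1) = n by omega]
    refine Finset.sum_congr rfl fun j _ => ?_
    rw [factor_shiftZ]
    congr 2
    ring
  rw [smul_smul, hne, hws, dist_eq_norm] at h1
  have h2 : ‖(n : ℝ)⁻¹ • (∑ j ∈ Finset.range n, f (shiftZ ((j : ℤ) + 1) ω)) -
      (n : ℝ)⁻¹ • ∑ j ∈ Finset.range n,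
        g (factor (shiftZ ((j : ℤ) + 1) ω) (-m) (2 * m + 1))‖ ≤ ε / 2 := by
    rw [← smul_sub, ← Finset.sum_sub_distrib, norm_smul, norm_inv, Real.norm_natCast,
      inv_mul_le_iff₀ hn]
    refine (norm_sum_le_of_le _ fun j _ => hfg _ (shiftZ_mem hΩ hp _)).trans ?_
    simp
  have := norm_sub_le_norm_sub_add_norm_sub
    ((n : ℝ)⁻¹ • (∑ j ∈ Finset.range n, f (shiftZ ((j : ℤ) + 1) ω)))
    ((n : ℝ)⁻¹ • ∑ j ∈ Finset.range n,
        g (factor (shiftZ ((j : ℤ) + 1) ω) (-m) (2 * m + 1))) y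
  linarith

theorem abs_occ_append_sub_le [Nonempty A] {v : List A} (hv : v ≠ []) (a b : List A) :
    |(occ v (a ++ b) : ℝ) - (occ v a + occ v b)| ≤ v.length := by
  classical
  obtain ⟨ω, hω⟩ := exists_eq_factor (a ++ b)
  rw [List.length_append, factor_add] at hω
  obtain ⟨ha, hb⟩ := List.append_inj hω (by simp)
  have hm : 0 < v.length := List.length_pos_iff.2 hv
  set m := v.length with hmdef
  set p := a.length
  set q := b.length
  set φ : ℕ → ℝ := fun i => if factor ω i m = v then 1 else 0 with hφdef
  have hφ : ∀ i, ‖φ i‖ ≤ 1 := by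
    intro i
    simp only [hφdef]
    split_ifs <;> simp
  have e1 : (occ v (a ++ b) : ℝ) = ∑ i ∈ Finset.range (p + q + 1 - m), φ i := by
    rw [hω, ← factor_add, occ_factor]
    simp [hφdef, ← hmdef]
  have e2 : (occ v a : ℝ) = ∑ i ∈ Finset.range (p + 1 - m), φ i := by
    rw [ha, occ_factor]
    simp [hφdef, ← hmdef]
  have e3 : (occ v b : ℝ) = ∑ i ∈ Finset.range (q + 1 - m), φ (p + i) := by
    rw [hb, occ_factor]
    simp [hφdef, ← hmdef]
  rw [e1, e2, e3]
  rcases le_or_gt m q with hmq | hmq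
  · rw [show p + q + 1 - m = p + (q + 1 - m) by omega, Finset.sum_range_add,
      add_sub_add_right_eq_sub]
    refine (norm_sum_range_sub_le hφ (by omega)).trans ?_
    have : (p : ℝ) ≤ m + (p + 1 - m : ℕ) := by exact_mod_cast (by omega)
    linarith
  · rw [show q + 1 - m = 0 by omega, Finset.sum_range_zero, add_zero]
    refine (norm_sum_range_sub_le hφ (by omega)).trans ?_
    have : ((p + q + 1 - m : ℕ) : ℝ) ≤ m + (p + 1 - m : ℕ) := by exact_mod_cast (by omega)
    linarith

theorem occ_le_length {v : List A} (hv : v ≠ []) (w : List A) : occ v w ≤ w.length := by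
  classical
  have hm : 0 < v.length := List.length_pos_iff.2 hv
  rw [occ_eq_card]
  refine (Finset.card_filter_le _ _).trans ?_
  rw [Finset.card_range]
  omega

theorem abs_occ_flatten_sub_le [Nonempty A] {v : List A} (hv : v ≠ []) (vs : List (List A)) :
    |(occ v vs.flatten : ℝ) - (vs.map fun w => (occ v w : ℝ)).sum| ≤
      (vs.map fun w => (v.length : ℝ) / (max w.length 1 : ℕ) * w.length).sum := by
  have h0 : occ v [] = 0 := by simpa using occ_le_length hv []
  induction vs with
  | nil => simp [h0]
  | cons a vs ih =>
    rw [List.flatten_cons, List.map_cons, List.sum_cons, List.map_cons, List.sum_cons]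
    rcases eq_or_ne a [] with rfl | ha
    · simpa [h0] using ih
    · have hpos : 1 ≤ a.length := List.length_pos_iff.2 ha
      have hne : (a.length : ℝ) ≠ 0 := by positivity
      rw [max_eq_left hpos, div_mul_cancel₀ _ hne]
      have h1 := abs_occ_append_sub_le hv a vs.flatten
      rw [abs_le] at h1 ih ⊢
      constructor <;> linarith [h1.1, h1.2, ih.1, ih.2]

theorem isAdditive_occ [Nonempty A] (W : Set (List A)) {v : List A} (hv : v ≠ []) :
    IsAdditive W (fun w => ULift.up (occ v w : ℝ)) := by
  refine ⟨1, one_pos, fun r => (v.length : ℝ) / (max r 1 : ℕ), ?_,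
    fun n => by positivity, ?_, ?_, ?_⟩
  · intro r s hrs
    have : (0 : ℝ) < (max r 1 : ℕ) := by positivity
    simp only
    gcongr
  · exact (tendsto_const_div_atTop_nhds_zero_nat _).comp
      (tendsto_atTop_mono (fun n => le_max_left n 1) tendsto_id)
  · intro vs _ _
    have hs (vs : List (List A)) : (vs.map fun w => ULift.up (occ v w : ℝ)).sum =
        ULift.up (vs.map fun w => (occ v w : ℝ)).sum := by
      induction vs with
      | nil => rfl
      | cons a vs ih =>
        rw [List.map_cons, List.sum_cons, ih, List.map_cons, List.sum_cons]
        rfl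
    rw [hs]
    exact abs_occ_flatten_sub_le hv vs
  · intro w _
    rw [one_mul, ULift.norm_def, Real.norm_natCast]
    exact_mod_cast occ_le_length hv w

theorem uniquelyErgodic_of_birkhoff [TopologicalSpace A] [DiscreteTopology A] [Finite A]
    {Ω : Set (ℤ → A)} (hΩ : IsSubshift Ω)
    (H : ∀ f : (ℤ → A) → ℝ, Continuous f →
      ∃ x : ℝ, ∀ ε : ℝ, 0 < ε → ∃ N : ℕ, ∀ n : ℕ, N ≤ n → ∀ ω ∈ Ω,
        ‖(n : ℝ)⁻¹ • (∑ j ∈ Finset.range n, f (shiftZ ((j : ℤ) + 1) ω)) - x‖ ≤ ε) :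
    UniquelyErgodic Ω := by
  classical
  intro v _
  set m := v.length with hm
  have hcont : Continuous fun ω : ℤ → A => if factor ω 0 m = v then (1 : ℝ) else 0 := by
    have h1 : Continuous fun ω : ℤ → A => fun i : Fin m => ω (0 + (i : ℕ)) := by fun_prop
    exact (continuous_of_discreteTopology
      (f := fun u : Fin m → A => if List.ofFn u = v then (1 : ℝ) else 0)).comp h1
  obtain ⟨x, hx⟩ := H _ hcont
  refine ⟨x, fun ε hε => ?_⟩
  obtain ⟨N, hN⟩ := hx (ε / 2) (half_pos hε)
  obtain ⟨M, hM⟩ := eventually_atTop.1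
    ((tendsto_const_div_atTop_nhds_zero_nat (m + 1 : ℝ)).eventually_le_const (half_pos hε))
  refine ⟨max N M, fun w hw hlen => ?_⟩
  obtain ⟨ω, hω, k, n, rfl⟩ := exists_factor_of_mem_words hw
  simp only [length_factor] at hlen ⊢
  have h1 := hN n ((le_max_left _ _).trans hlen) _ (shiftZ_mem hΩ hω (k - 1))
  have h2 := hM n ((le_max_right _ _).trans hlen)
  set φ : ℕ → ℝ := fun i => if factor ω (k + i) m = v then 1 else 0 with hφdef
  have hφ : ∀ i, ‖φ i‖ ≤ 1 := by
    intro i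
    simp only [hφdef]
    split_ifs <;> simp
  have h3 : ∀ j : ℕ, factor (shiftZ ((j : ℤ) + 1) (shiftZ (k - 1) ω)) 0 m =
      factor ω (k + j) m := by
    intro j
    rw [factor_shiftZ, factor_shiftZ]
    congr 1
    ring
  simp only [h3] at h1
  have h4 : ‖(occ v (factor ω k n) : ℝ) - ∑ j ∈ Finset.range n, φ j‖ ≤ m + 1 := by
    rw [occ_factor, ← hm]
    rcases le_total (n + 1 - m) n with hle | hle
    · rw [norm_sub_rev]
      refine (norm_sum_range_sub_le hφ hle).trans ?_
      have : (n : ℝ) ≤ m + (n + 1 - m : ℕ) := by exact_mod_cast (by omega)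
      linarith
    · refine (norm_sum_range_sub_le hφ hle).trans ?_
      have : ((n + 1 - m : ℕ) : ℝ) ≤ n + 1 := by exact_mod_cast (by omega)
      have : (0 : ℝ) ≤ m := by positivity
      linarith
  have h5 : ‖(occ v (factor ω k n) : ℝ) / n - (n : ℝ)⁻¹ • ∑ j ∈ Finset.range n, φ j‖ ≤ ε / 2 := by
    rw [smul_eq_mul, ← div_eq_inv_mul, ← sub_div, norm_div, Real.norm_natCast]
    exact (div_le_div_of_nonneg_right h4 (by positivity)).trans h2
  have := norm_sub_le_norm_sub_add_norm_sub ((occ v (factor ω k n) : ℝ) / n)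
    ((n : ℝ)⁻¹ • ∑ j ∈ Finset.range n, φ j) x
  linarith

theorem occ_nil (w : List A) : occ [] w = w.length + 1 := by
  classical
  simp [occ_eq_card]

theorem tendstoWords_occ_nil (W : Set (List A)) :
    TendstoWords W (fun w => (occ [] w : ℝ) / (w.length : ℝ)) 1 := by
  rw [tendstoWords_iff]
  have hlen := tendsto_len_lenFilter W List.length
  have h := ((tendsto_const_div_atTop_nhds_zero_nat (1 : ℝ)).comp hlen).const_add 1
  rw [add_zero] at h
  refine h.congr' ?_
  filter_upwards [hlen.eventually_gt_atTop 0] with w hw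
  have : (w.length : ℝ) ≠ 0 := by positivity
  rw [occ_nil]
  simp only [Function.comp_apply]
  push_cast
  field_simp

/-- For a minimal subshift, unique ergodicity, the uniform additive ergodic
theorem and the uniform Banach-valued Birkhoff theorem are equivalent. -/
theorem additive_ergodic_tfae
    {A : Type*} [Fintype A] [Nonempty A] [TopologicalSpace A] [DiscreteTopology A]
    (Ω : Set (ℤ → A)) (hΩ : IsSubshift Ω) (hne : Ω.Nonempty) (hmin : IsMinimal Ω) :
    [ UniquelyErgodic Ω,
      ∀ (B : Type*) [NormedAddCommGroup B] [NormedSpace ℝ B] [CompleteSpace B]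
        (F : List A → B), IsAdditive (words Ω) F →
          ∃ x : B, TendstoWords (words Ω) (fun w => ((w.length : ℝ))⁻¹ • F w) x,
      ∀ (B : Type*) [NormedAddCommGroup B] [NormedSpace ℝ B] [CompleteSpace B]
        (f : (ℤ → A) → B), ContinuousOn f Ω →
          ∃ x : B, ∀ ε : ℝ, 0 < ε → ∃ N : ℕ, ∀ n : ℕ, N ≤ n → ∀ ω ∈ Ω,
            ‖(n : ℝ)⁻¹ • (∑ j ∈ Finset.range n, f (shiftZ ((j : ℤ) + 1) ω)) - x‖ ≤ ε
    ].TFAE := by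
  tfae_have 1 → 2 := fun h B _ _ _ F hF => h.exists_tendstoWords hF
  tfae_have 1 → 3 := fun h B _ _ _ f hf => h.exists_birkhoff_limit hΩ hf
  tfae_have 2 → 1 := by
    intro h v _
    rcases eq_or_ne v [] with rfl | hv
    · exact ⟨1, tendstoWords_occ_nil _⟩
    · obtain ⟨x, hx⟩ := h (ULift ℝ) _ (isAdditive_occ (words Ω) hv)
      refine ⟨x.down, fun ε hε => ?_⟩
      obtain ⟨L, hL⟩ := hx ε hε
      refine ⟨L, fun w hw hlen => ?_⟩
      beta_reduce
      rw [div_eq_inv_mul]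
      exact hL w hw hlen
  tfae_have 3 → 1 := by
    intro h
    refine uniquelyErgodic_of_birkhoff hΩ fun f hf => ?_
    obtain ⟨x, hx⟩ := h (ULift ℝ) (fun ω => ULift.up (f ω))
      (continuous_uliftUp.comp hf).continuousOn
    refine ⟨x.down, fun ε hε => ?_⟩
    obtain ⟨N, hN⟩ := hx ε hε
    refine ⟨N, fun n hn ω hω => ?_⟩
    have hs : ∑ j ∈ Finset.range n, ULift.up (f (shiftZ ((j : ℤ) + 1) ω)) =
        ULift.up (∑ j ∈ Finset.range n, f (shiftZ ((j : ℤ) + 1) ω)) :=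
      (map_sum (AddEquiv.ulift.symm : ℝ ≃+ ULift ℝ) _ _).symm
    have := hN n hn ω hω
    rw [hs] at this
    exact this
  tfae_finish

end SubshiftErgodic
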